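/- For every ε > 0 there exist b > 0 and a smooth curve z = (x, y) : [0, b] → ℝ² such that ‖z'(s)‖ = 1 for all s ∈ [0, b], z(0) = z(b), x'(0) = 1, x'(b) = −1, y'(0) = y'(b) = 0, and the total absolute curvature satisfies ∫₀^b ‖z''(s)‖ ds < π + ε. -/

import Mathlib

open Real Set

lemma hasDerivAt_euclidean_two {x y : ℝ → ℝ} {x' y' s : ℝ}
    (hx : HasDerivAt x x' s) (hy : HasDerivAt y y' s) :
    HasDerivAt (fun t => (!₂[x t, y t] : EuclideanSpace ℝ (Fin 2))) !₂[x', y'] s := by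
  have h : HasDerivAt (fun t => ![x t, y t]) ![x', y'] s := by
    rw [hasDerivAt_pi]
    intro i
    fin_cases i
    · exact hx
    · exact hy
  exact (PiLp.hasFDerivAt_toLp 2 _).comp_hasDerivAt s h

/-- The planar curve starting at the origin with unit tangent of angle `θ`. -/
noncomputable def curveOfAngle (θ : ℝ → ℝ) (s : ℝ) : EuclideanSpace ℝ (Fin 2) :=
  !₂[∫ t in (0 : ℝ)..s, cos (θ t), ∫ t in (0 : ℝ)..s, sin (θ t)]

lemma deriv_curveOfAngle {θ : ℝ → ℝ} (hθ : Continuous θ) :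
    deriv (curveOfAngle θ) = fun s => !₂[cos (θ s), sin (θ s)] := by
  funext s
  exact (hasDerivAt_euclidean_two
    ((continuous_cos.comp hθ).integral_hasStrictDerivAt 0 s).hasDerivAt
    ((continuous_sin.comp hθ).integral_hasStrictDerivAt 0 s).hasDerivAt).deriv

lemma norm_deriv_curveOfAngle {θ : ℝ → ℝ} (hθ : Continuous θ) (s : ℝ) :
    ‖deriv (curveOfAngle θ) s‖ = 1 := by
  rw [deriv_curveOfAngle hθ, EuclideanSpace.norm_eq]
  simp [Fin.sum_univ_two]

lemma contDiff_curveOfAngle {θ : ℝ → ℝ} (hθ : ContDiff ℝ (⊤ : ℕ∞) θ) :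
    ContDiff ℝ (⊤ : ℕ∞) (curveOfAngle θ) := by
  rw [contDiff_infty_iff_deriv]
  refine ⟨fun s => differentiableAt_of_deriv_ne_zero ?_, ?_⟩
  · rw [← norm_ne_zero_iff, norm_deriv_curveOfAngle hθ.continuous]
    exact one_ne_zero
  · rw [deriv_curveOfAngle hθ.continuous, contDiff_euclidean]
    intro i
    fin_cases i
    · exact hθ.cos
    · exact hθ.sin

lemma norm_deriv_deriv_curveOfAngle {θ : ℝ → ℝ} (hθ : Differentiable ℝ θ) (s : ℝ) :
    ‖deriv (deriv (curveOfAngle θ)) s‖ = |deriv θ s| := by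
  rw [deriv_curveOfAngle hθ.continuous,
    (hasDerivAt_euclidean_two (hθ s).hasDerivAt.cos (hθ s).hasDerivAt.sin).deriv,
    EuclideanSpace.norm_eq, ← sqrt_sq_eq_abs]
  congr 1
  simp only [Fin.sum_univ_two, norm_eq_abs, sq_abs, Matrix.cons_val_zero, Matrix.cons_val_one]
  linear_combination (deriv θ s) ^ 2 * sin_sq_add_cos_sq (θ s)

lemma hasDerivAt_smoothTransition (x : ℝ) :
    HasDerivAt smoothTransition (deriv smoothTransition x) x :=
  ((smoothTransition.contDiff (n := 1)).differentiable (by norm_num) x).hasDerivAt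

lemma continuous_deriv_smoothTransition : Continuous (deriv smoothTransition) :=
  (smoothTransition.contDiff (n := 1)).continuous_deriv le_rfl

lemma integral_deriv_smoothTransition_sub_le (c a b : ℝ) :
    ∫ s in a..b, deriv smoothTransition (s - c) ≤ 1 := by
  rw [intervalIntegral.integral_comp_sub_right (deriv smoothTransition),
    intervalIntegral.integral_deriv_eq_sub
      (fun x _ => (hasDerivAt_smoothTransition x).differentiableAt)
      (continuous_deriv_smoothTransition.intervalIntegrable _ _)]
  linarith [smoothTransition.le_one (b - c), smoothTransition.nonneg (a - c)]

/-- An angle function that dips from `0` to `-δ` and then climbs to `π / 2`, staying negative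
long enough for the height gained by the corresponding curve to vanish at time `h`. -/
lemma exists_dipping_angle {δ : ℝ} (hδ : 0 < δ) (hδ' : δ ≤ 1) :
    ∃ (ψ : ℝ → ℝ) (h : ℝ), ContDiff ℝ (⊤ : ℕ∞) ψ ∧ 0 < h ∧ ψ 0 = 0 ∧
      (∀ s, h ≤ s → ψ s = π / 2) ∧ (∫ s in (0 : ℝ)..h, sin (ψ s)) = 0 ∧
      ∀ b, 0 ≤ b → (∫ s in (0 : ℝ)..b, |deriv ψ s|) ≤ π / 2 + 2 * δ := by
  have hπ := pi_gt_three
  have hsin : 0 < sin δ := sin_pos_of_pos_of_lt_pi hδ (by linarith)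
  obtain ⟨P, hP0, hP⟩ : ∃ P : ℝ, 0 < P ∧ P * sin δ = 1 :=
    ⟨(sin δ)⁻¹, inv_pos.2 hsin, inv_mul_cancel₀ hsin.ne'⟩
  let ψ : ℝ → ℝ := fun s =>
    -δ * smoothTransition s + (π / 2 + δ) * smoothTransition (s - (1 + P))
  have hψ : ContDiff ℝ (⊤ : ℕ∞) ψ :=
    (contDiff_const.mul smoothTransition.contDiff).add
      (contDiff_const.mul (smoothTransition.contDiff.comp (contDiff_id.sub contDiff_const)))
  have hint : ∀ a b, IntervalIntegrable (fun s => sin (ψ s)) MeasureTheory.volume a b :=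
    fun a b => (continuous_sin.comp hψ.continuous).intervalIntegrable a b
  have hend : ∀ s, 2 + P ≤ s → ψ s = π / 2 := fun s hs => by
    simp only [ψ]
    rw [smoothTransition.one_of_one_le (by linarith), smoothTransition.one_of_one_le (by linarith)]
    ring
  have hdip : ∀ s, s ≤ 1 + P → ψ s = -δ * smoothTransition s := fun s hs => by
    simp only [ψ]
    rw [smoothTransition.zero_of_nonpos (x := s - (1 + P)) (by linarith)]
    ring
  have h₁ : (∫ s in (0 : ℝ)..1, sin (ψ s)) ≤ 0 := by
    have := intervalIntegral.integral_mono_on zero_le_one (hint 0 1)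
      (intervalIntegrable_const (c := (0 : ℝ))) fun s hs => by
        rw [hdip s (by linarith [hs.2])]
        have h0 := smoothTransition.nonneg s
        have h1 := smoothTransition.le_one s
        exact sin_nonpos_of_nonpos_of_neg_pi_le (by nlinarith) (by nlinarith)
    simpa using this
  have h₂ : (∫ s in (1 : ℝ)..1 + P, sin (ψ s)) = -1 := by
    rw [intervalIntegral.integral_congr (g := fun _ => -sin δ)]
    · simp [hP]
    · intro s hs
      rw [uIcc_of_le (by linarith)] at hs
      simp only
      rw [hdip s hs.2, smoothTransition.one_of_one_le hs.1, mul_one, sin_neg]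
  have h₃ : (∫ s in (1 + P)..(2 + P), sin (ψ s)) ≤ 1 := by
    have := intervalIntegral.integral_mono_on (by linarith) (hint (1 + P) (2 + P))
      (intervalIntegrable_const (c := (1 : ℝ))) fun s _ => sin_le_one _
    rw [intervalIntegral.integral_const, smul_eq_mul] at this
    linarith
  have hY : (∫ s in (0 : ℝ)..(2 + P), sin (ψ s)) ≤ 0 := by
    rw [← intervalIntegral.integral_add_adjacent_intervals (hint 0 (1 + P)) (hint _ _),
      ← intervalIntegral.integral_add_adjacent_intervals (hint 0 1) (hint _ _)]
    linarith
  set Y := ∫ s in (0 : ℝ)..(2 + P), sin (ψ s) with hYdef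
  refine ⟨ψ, 2 + P - Y, hψ, by linarith, ?_, fun s hs => hend s (by linarith), ?_, fun b hb => ?_⟩
  · rw [hdip 0 (by linarith), smoothTransition.zero, mul_zero]
  · rw [← intervalIntegral.integral_add_adjacent_intervals (hint 0 (2 + P)) (hint _ (2 + P - Y)),
      ← hYdef,
      intervalIntegral.integral_congr (a := 2 + P) (g := fun _ => (1 : ℝ))]
    · simp
    · intro s hs
      rw [uIcc_of_le (by linarith)] at hs
      simp only
      rw [hend s hs.1, sin_pi_div_two]
  · have hd : ∀ s, deriv ψ s = -δ * deriv smoothTransition s +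
        (π / 2 + δ) * deriv smoothTransition (s - (1 + P)) := fun s =>
      (((hasDerivAt_smoothTransition s).const_mul _).add
        (((hasDerivAt_smoothTransition _).comp_sub_const s (1 + P)).const_mul _)).deriv
    have hc₁ : Continuous fun s => δ * deriv smoothTransition (s - 0) :=
      continuous_const.mul (continuous_deriv_smoothTransition.comp (continuous_sub_right 0))
    have hc₂ : Continuous fun s => (π / 2 + δ) * deriv smoothTransition (s - (1 + P)) :=
      continuous_const.mul (continuous_deriv_smoothTransition.comp (continuous_sub_right _))
    have hle := intervalIntegral.integral_mono_on (μ := MeasureTheory.volume) hb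
      ((hψ.continuous_deriv (by simp)).abs.intervalIntegrable 0 b)
      ((hc₁.add hc₂).intervalIntegrable 0 b) fun s _ => by
        have h0 : 0 ≤ deriv smoothTransition s := smoothTransition.monotone.deriv_nonneg
        have h1 : 0 ≤ deriv smoothTransition (s - (1 + P)) :=
          smoothTransition.monotone.deriv_nonneg
        have h2 : 0 ≤ δ * deriv smoothTransition s := by positivity
        have h3 : 0 ≤ (π / 2 + δ) * deriv smoothTransition (s - (1 + P)) := by positivity
        rw [hd, abs_le]
        simp only [Pi.add_apply, sub_zero]
        constructor <;> linarith
    simp only [Pi.add_apply] at hle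
    rw [intervalIntegral.integral_add (hc₁.intervalIntegrable _ _) (hc₂.intervalIntegrable _ _),
      intervalIntegral.integral_const_mul, intervalIntegral.integral_const_mul] at hle
    have i₁ := integral_deriv_smoothTransition_sub_le 0 0 b
    have i₂ := integral_deriv_smoothTransition_sub_le (1 + P) 0 b
    have j₁ := mul_le_mul_of_nonneg_left i₁ hδ.le
    have j₂ := mul_le_mul_of_nonneg_left i₂ (show 0 ≤ π / 2 + δ by positivity)
    linarith

/-- The "teardrop curve" lemma (Lemma 2.2 of Miura): for every `ε > 0` there is a
closed unit-speed planar curve whose endpoint tangents are the opposite horizontal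
unit vectors and whose total absolute curvature is less than `π + ε`. -/
theorem exists_teardrop_curve (ε : ℝ) (hε : 0 < ε) :
    ∃ (b : ℝ) (z : ℝ → EuclideanSpace ℝ (Fin 2)), 0 < b ∧ ContDiff ℝ (⊤ : ℕ∞) z ∧
      (∀ s ∈ Icc (0 : ℝ) b, ‖deriv z s‖ = 1) ∧
      z 0 = z b ∧
      deriv z 0 0 = 1 ∧ deriv z b 0 = -1 ∧
      deriv z 0 1 = 0 ∧ deriv z b 1 = 0 ∧
      (∫ s in (0 : ℝ)..b, ‖deriv (deriv z) s‖) < π + ε := by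
  obtain ⟨δ, hδ, hδ1, hδε⟩ : ∃ δ : ℝ, 0 < δ ∧ δ ≤ 1 ∧ δ ≤ ε / 8 :=
    ⟨min 1 (ε / 8), by positivity, min_le_left _ _, min_le_right _ _⟩
  obtain ⟨ψ, h, hψ, hh, hψ0, hψh, hψint, hψvar⟩ := exists_dipping_angle hδ hδ1
  let θ : ℝ → ℝ := fun s => ψ s + π / 2 - ψ (2 * h - s)
  have hθ : ContDiff ℝ (⊤ : ℕ∞) θ :=
    (hψ.add contDiff_const).sub (hψ.comp (contDiff_const.sub contDiff_id))
  have hθc := hθ.continuous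
  have hsymm : ∀ s, θ (2 * h - s) = π - θ s := fun s => by
    simp only [θ, sub_sub_cancel]
    ring
  have hθ0 : θ 0 = 0 := by
    simp only [θ]
    rw [hψ0, hψh _ (by linarith)]
    ring
  have hθb : θ (2 * h) = π := by simpa [hθ0] using hsymm 0
  have hcos : (∫ s in (0 : ℝ)..2 * h, cos (θ s)) = 0 := by
    have := intervalIntegral.integral_comp_sub_left (a := 0) (b := 2 * h)
      (fun s => cos (θ s)) (2 * h)
    simp only [hsymm, cos_pi_sub, intervalIntegral.integral_neg, sub_self, sub_zero] at this
    linarith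
  have hsin_left : (∫ s in (0 : ℝ)..h, sin (θ s)) = 0 := by
    refine Eq.trans ?_ hψint
    refine intervalIntegral.integral_congr (f := fun s => sin (θ s)) fun s hs => ?_
    rw [uIcc_of_le hh.le] at hs
    simp only [θ]
    rw [hψh (2 * h - s) (by linarith [hs.2]), add_sub_cancel_right]
  have hsin : (∫ s in (0 : ℝ)..2 * h, sin (θ s)) = 0 := by
    have hint : ∀ a b, IntervalIntegrable (fun s => sin (θ s)) MeasureTheory.volume a b :=
      fun a b => (continuous_sin.comp hθc).intervalIntegrable a b
    have := intervalIntegral.integral_comp_sub_left (a := 0) (b := h)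
      (fun s => sin (θ s)) (2 * h)
    simp only [hsymm, sin_pi_sub, sub_zero, hsin_left] at this
    rw [two_mul, add_sub_cancel_right] at this
    rw [two_mul, ← intervalIntegral.integral_add_adjacent_intervals (hint 0 h) (hint _ _),
      hsin_left, ← this, add_zero]
  have hvar : (∫ s in (0 : ℝ)..2 * h, |deriv θ s|) ≤ π + 4 * δ := by
    have hψd : Differentiable ℝ ψ := hψ.differentiable (by simp)
    have hd : ∀ s, deriv θ s = deriv ψ s + deriv ψ (2 * h - s) := fun s => by
      have := (((hψd s).hasDerivAt.add_const (π / 2)).sub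
        ((hψd (2 * h - s)).hasDerivAt.comp_const_sub (2 * h) s)).deriv
      rw [sub_neg_eq_add] at this
      exact this
    have hc : Continuous fun s => |deriv ψ s| := (hψ.continuous_deriv (by simp)).abs
    have hc' : Continuous fun s => |deriv ψ (2 * h - s)| :=
      hc.comp (continuous_const.sub continuous_id)
    have hle := intervalIntegral.integral_mono_on (μ := MeasureTheory.volume)
      (by linarith : (0 : ℝ) ≤ 2 * h)
      ((hθ.continuous_deriv (by simp)).abs.intervalIntegrable _ _)
      ((hc.add hc').intervalIntegrable _ _) fun s _ => by
        rw [hd]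
        exact abs_add_le _ _
    simp only [Pi.add_apply] at hle
    rw [intervalIntegral.integral_add (hc.intervalIntegrable _ _) (hc'.intervalIntegrable _ _),
      intervalIntegral.integral_comp_sub_left (fun s => |deriv ψ s|), sub_self, sub_zero] at hle
    linarith [hψvar (2 * h) (by linarith)]
  refine ⟨2 * h, curveOfAngle θ, by linarith, contDiff_curveOfAngle hθ,
    fun s _ => norm_deriv_curveOfAngle hθc s, ?_, ?_, ?_, ?_, ?_, ?_⟩
  · simp only [curveOfAngle, intervalIntegral.integral_same, hcos, hsin]
  · simp [deriv_curveOfAngle hθc, hθ0]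
  · simp [deriv_curveOfAngle hθc, hθb]
  · simp [deriv_curveOfAngle hθc, hθ0]
  · simp [deriv_curveOfAngle hθc, hθb]
  · simp only [norm_deriv_deriv_curveOfAngle (hθ.differentiable (by simp))]
    linarith
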